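/- Let ν be a σ-finite Borel measure on (0,∞) with M₁ = ∫₀^∞ z ν(dz) ∈ (0,1), let ρ be a Borel probability measure on (0,∞), w ∈ [0,1], θ ≥ 0, T > 0, and set φ̄ = θ/(1−M₁). For every bounded continuous φ : [0,T] × (0,∞) → ℝ with truncation φ̂ = max(0, min(φ̄, φ)), the function 𝔾(φ̂)(t,r) = θ·e^{−r t} + ∫₀ᵗ e^{−r(t−s)} r [ w ∫₀^∞ (1 − e^{−φ̂(s,r) z}) ν(dz) + (1−w) ∫₀^∞ ∫₀^∞ (1 − e^{−φ̂(s,u) z}) ν(dz) ρ(du) ] ds satisfies sup_{(t,r) ∈ [0,T]×(0,∞)} |𝔾(φ̂)(t,r)| ≤ θ + M₁ φ̄ = θ/(1−M₁). -/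

import Mathlib

open MeasureTheory

/-- The Riccati operator `𝔾` of the aggregation model. -/
noncomputable def riccatiOp (ν ρ : Measure ℝ) (w θ : ℝ)
    (φ : ℝ → ℝ → ℝ) (t r : ℝ) : ℝ :=
  θ * Real.exp (-(r * t)) +
    ∫ s in (0:ℝ)..t, Real.exp (-(r * (t - s))) * r *
      (w * (∫ z in Set.Ioi (0:ℝ), (1 - Real.exp (-(φ s r * z))) ∂ν) +
       (1 - w) * ∫ u in Set.Ioi (0:ℝ),
          (∫ z in Set.Ioi (0:ℝ), (1 - Real.exp (-(φ s u * z))) ∂ν) ∂ρ)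

/-- Truncation `φ̂ = max(0, min(c, φ))` at level `c`. -/
noncomputable def truncate (c : ℝ) (φ : ℝ → ℝ → ℝ) : ℝ → ℝ → ℝ :=
  fun t r => max 0 (min c (φ t r))

/-- The Laplace-type exponent at a level in `[0, c]` is bounded by `c` times the first moment. -/
theorem abs_setIntegral_one_sub_exp_le {ν : Measure ℝ}
    (hν : IntegrableOn (fun z : ℝ => z) (Set.Ioi 0) ν) {a c : ℝ} (ha : 0 ≤ a) (hac : a ≤ c) :
    |∫ z in Set.Ioi (0:ℝ), (1 - Real.exp (-(a * z))) ∂ν| ≤ c * ∫ z in Set.Ioi (0:ℝ), z ∂ν := by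
  rw [← integral_const_mul, ← Real.norm_eq_abs]
  refine norm_integral_le_of_norm_le (hν.const_mul c) ?_
  filter_upwards [ae_restrict_mem measurableSet_Ioi] with z hz
  have hz : 0 < z := hz
  have haz : 0 ≤ a * z := by positivity
  have h1 : Real.exp (-(a * z)) ≤ 1 := Real.exp_le_one_iff.2 (by linarith)
  have h2 := Real.add_one_le_exp (-(a * z))
  have h3 : a * z ≤ c * z := by gcongr
  rw [Real.norm_eq_abs, abs_of_nonneg (by linarith)]
  linarith

/-- A set integral against a probability measure inherits a uniform bound on the integrand. -/
theorem abs_setIntegral_le_of_abs_le {ρ : Measure ℝ} [IsProbabilityMeasure ρ] {f : ℝ → ℝ} {B : ℝ}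
    (hB : 0 ≤ B) (hf : ∀ u, |f u| ≤ B) (s : Set ℝ) : |∫ u in s, f u ∂ρ| ≤ B := by
  have h := norm_setIntegral_le_of_norm_le_const (μ := ρ) (s := s) (f := f)
    (measure_lt_top ρ s) fun u _ => hf u
  exact h.trans (mul_le_of_le_one_right hB measureReal_le_one)

theorem integral_exp_neg_mul_sub_mul (r t : ℝ) :
    ∫ s in (0:ℝ)..t, Real.exp (-(r * (t - s))) * r = 1 - Real.exp (-(r * t)) := by
  have hd (s : ℝ) : HasDerivAt (fun s => Real.exp (-(r * (t - s))))
      (Real.exp (-(r * (t - s))) * r) s := by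
    have h : HasDerivAt (fun s => -(r * (t - s))) r s := by
      simpa using (((hasDerivAt_id s).const_sub t).const_mul r).fun_neg
    exact h.exp
  rw [intervalIntegral.integral_eq_sub_of_hasDerivAt (fun s _ => hd s)
    (Continuous.intervalIntegrable (by fun_prop) _ _)]
  simp

/-- A convolution with the exponential kernel `r e^{-r(t-s)}` inherits a uniform bound on the
integrand. -/
theorem abs_integral_exp_kernel_mul_le {r t B : ℝ} (hr : 0 ≤ r) (ht : 0 ≤ t) (hB : 0 ≤ B)
    {f : ℝ → ℝ} (hf : ∀ s, |f s| ≤ B) :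
    |∫ s in (0:ℝ)..t, Real.exp (-(r * (t - s))) * r * f s| ≤ B := by
  have h : |∫ s in (0:ℝ)..t, Real.exp (-(r * (t - s))) * r * f s|
      ≤ ∫ s in (0:ℝ)..t, Real.exp (-(r * (t - s))) * r * B := by
    rw [← Real.norm_eq_abs]
    refine intervalIntegral.norm_integral_le_of_norm_le ht (ae_of_all _ fun s _ => ?_)
      (Continuous.intervalIntegrable (by fun_prop) _ _)
    rw [Real.norm_eq_abs, abs_mul, abs_of_nonneg (by positivity)]
    gcongr
    exact hf s
  rw [intervalIntegral.integral_mul_const, integral_exp_neg_mul_sub_mul] at h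
  nlinarith [Real.exp_pos (-(r * t))]

/-- Uniform bound for the truncated Riccati operator:
`sup |𝔾(φ̂)| ≤ θ + M₁ φ̄ = θ/(1-M₁)` with truncation level `φ̄ = θ/(1-M₁)`. -/
theorem truncated_riccatiOp_sup_bound
    (ν ρ : Measure ℝ) [SigmaFinite ν] [IsProbabilityMeasure ρ]
    (hν : ν (Set.Iic 0) = 0) (hρ : ρ (Set.Iic 0) = 0)
    (hνInt : IntegrableOn (fun z : ℝ => z) (Set.Ioi 0) ν)
    (M₁ : ℝ) (hM₁ : M₁ = ∫ z in Set.Ioi (0:ℝ), z ∂ν)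
    (hM₁pos : 0 < M₁) (hM₁lt : M₁ < 1)
    (w : ℝ) (hw : w ∈ Set.Icc (0:ℝ) 1)
    (θ : ℝ) (hθ : 0 ≤ θ) (T : ℝ) (hT : 0 < T)
    (φ : ℝ → ℝ → ℝ)
    (hφc : ContinuousOn (fun p : ℝ × ℝ => φ p.1 p.2) (Set.Icc 0 T ×ˢ Set.Ioi 0))
    (hφb : ∃ C : ℝ, ∀ t ∈ Set.Icc (0:ℝ) T, ∀ r ∈ Set.Ioi (0:ℝ), |φ t r| ≤ C) :
    ∀ t ∈ Set.Icc (0:ℝ) T, ∀ r ∈ Set.Ioi (0:ℝ),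
      |riccatiOp ν ρ w θ (truncate (θ / (1 - M₁)) φ) t r|
        ≤ θ + M₁ * (θ / (1 - M₁)) ∧
      θ + M₁ * (θ / (1 - M₁)) = θ / (1 - M₁) := by
  intro t ht r hr
  have hr : 0 < r := hr
  have hM : 0 < 1 - M₁ := by linarith
  refine ⟨?_, by field_simp; ring⟩
  set c := θ / (1 - M₁)
  have hc : 0 ≤ c := div_nonneg hθ hM.le
  have hB : 0 ≤ M₁ * c := by positivity
  have hinner (s u : ℝ) :
      |∫ z in Set.Ioi (0:ℝ), (1 - Real.exp (-(truncate c φ s u * z))) ∂ν| ≤ M₁ * c := by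
    rw [hM₁, mul_comm]
    exact abs_setIntegral_one_sub_exp_le hνInt (le_max_left _ _)
      (max_le hc (min_le_left _ _))
  have hexp : Real.exp (-(r * t)) ≤ 1 :=
    Real.exp_le_one_iff.2 (neg_nonpos.2 (mul_nonneg hr.le ht.1))
  refine (abs_add_le _ _).trans (add_le_add ?_ ?_)
  · rw [abs_of_nonneg (by positivity)]
    exact mul_le_of_le_one_right hθ hexp
  · refine abs_integral_exp_kernel_mul_le hr.le ht.1 hB fun s => ?_
    have hw' : 0 ≤ 1 - w := sub_nonneg.2 hw.2
    refine (abs_add_le _ _).trans ?_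
    rw [abs_mul, abs_mul, abs_of_nonneg hw.1, abs_of_nonneg hw']
    have h1 := mul_le_mul_of_nonneg_left (hinner s r) hw.1
    have h2 := mul_le_mul_of_nonneg_left
      (abs_setIntegral_le_of_abs_le (ρ := ρ) hB (hinner s) (Set.Ioi 0)) hw'
    linarith
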